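/- Let μ be a symplectic partition of the even number 2m, and let k > 0 be odd with μ_k ≥ μ_{k+1} + 2. Define ν by ν_j = μ_j − 2 for j ≤ k and ν_j = μ_j for j > k. Then ν is a symplectic partition of 2(m−k); if μ is special then ν is special; and if σ is a B-collapse of (ν^t)^+ and τ is a B-collapse of (μ^t)^+, then τ = σ ∪ (k,k). -/

import Mathlib

/-- `f` is a partition of `d`: weakly decreasing, finitely many nonzero terms, total sum `d`.
    Indexing is 0-based: `f j` is the `(j+1)`-st part. -/
def IsPartitionOf (f : ℕ → ℕ) (d : ℕ) : Prop :=
  Antitone f ∧ ∃ N, (∀ j, N ≤ j → f j = 0) ∧ ∑ j ∈ Finset.range N, f j = d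

/-- Transpose of a partition (0-based): `ptrans f k` = #{j : f j ≥ k+1}, i.e. `(f^t)_{k+1}`. -/
noncomputable def ptrans (f : ℕ → ℕ) : ℕ → ℕ := fun k => Nat.card {j : ℕ // k + 1 ≤ f j}

/-- Multiplicity of the part `k` in `f` (meaningful for `k > 0`). -/
noncomputable def pmult (f : ℕ → ℕ) (k : ℕ) : ℕ := Nat.card {j : ℕ // f j = k}

/-- Orthogonal: every even positive part occurs with even multiplicity. -/
def IsOrthogonal (f : ℕ → ℕ) : Prop := ∀ k, 0 < k → Even k → Even (pmult f k)

/-- Symplectic: every odd positive part occurs with even multiplicity. -/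
def IsSymplectic (f : ℕ → ℕ) : Prop := ∀ k, 0 < k → Odd k → Even (pmult f k)

/-- Dominance order for ℕ-valued sequences. -/
def NDomLE (f g : ℕ → ℕ) : Prop :=
  ∀ N, ∑ j ∈ Finset.range N, f j ≤ ∑ j ∈ Finset.range N, g j

/-- Dominance order for ℤ-valued sequences. -/
def DomLE (f g : ℕ → ℤ) : Prop :=
  ∀ N, ∑ j ∈ Finset.range N, f j ≤ ∑ j ∈ Finset.range N, g j

/-- `ν` is the `P`-collapse of `μ` (both of total size `m`): `ν` is a partition of `m`
    satisfying `P`, `ν ≤ μ`, and every partition `σ` of `m` satisfying `P` with `σ ≤ μ`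
    satisfies `σ ≤ ν`. -/
def IsCollapse (P : (ℕ → ℕ) → Prop) (m : ℕ) (μ ν : ℕ → ℕ) : Prop :=
  IsPartitionOf ν m ∧ P ν ∧ NDomLE ν μ ∧
    ∀ σ, IsPartitionOf σ m → P σ → NDomLE σ μ → NDomLE σ ν

/-- B-collapse (largest orthogonal partition below `μ`, `m` odd). -/
def IsBCollapse : ℕ → (ℕ → ℕ) → (ℕ → ℕ) → Prop := IsCollapse IsOrthogonal
/-- C-collapse (largest symplectic partition below `μ`, `m` even). -/
def IsCCollapse : ℕ → (ℕ → ℕ) → (ℕ → ℕ) → Prop := IsCollapse IsSymplectic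
/-- D-collapse (largest orthogonal partition below `μ`, `m` even). -/
def IsDCollapse : ℕ → (ℕ → ℕ) → (ℕ → ℕ) → Prop := IsCollapse IsOrthogonal

/-- `μ^−` : decrease the smallest nonzero part by 1. -/
def minusOne (f : ℕ → ℕ) : ℕ → ℕ :=
  fun j => if 0 < f j ∧ f (j+1) = 0 then f j - 1 else f j

/-- `μ^+` : increase the largest part by 1. -/
def plusOne (f : ℕ → ℕ) : ℕ → ℕ := fun j => if j = 0 then f 0 + 1 else f j

/-- `u = f ∪ g` : `u` is weakly decreasing, finitely supported, and every positive
    part occurs in `u` with multiplicity the sum of its multiplicities in `f` and `g`. -/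
def IsUnionOf (u f g : ℕ → ℕ) : Prop :=
  Antitone u ∧ (∃ N, ∀ j, N ≤ j → u j = 0) ∧
    ∀ k, 0 < k → pmult u k = pmult f k + pmult g k

/-- The sequence ξ attached to `(f, g, ε₁, ε₂, d)`.  Index `j` here corresponds to the
    1-based index `j+1` of the paper. -/
def xiSeq (f g : ℕ → ℕ) (e1 e2 d : ℕ) : ℕ → ℤ := fun j =>
  if (j + 1) % 2 = (d + 1) % 2 ∧ f j % 2 = e1 ∧ g j % 2 = e2 ∧
      (j = 0 ∨ f j + g j < f (j - 1) + g (j - 1)) then 1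
  else if (j + 1) % 2 = d % 2 ∧ f j % 2 = e1 ∧ g j % 2 = e2 ∧
      f (j + 1) + g (j + 1) < f j + g j then -1
  else 0

/-- The Waldspurger sequence `W(f,g) = f + g + ξ` (ℤ-valued a priori). -/
def wald (f g : ℕ → ℕ) (e1 e2 d : ℕ) : ℕ → ℤ :=
  fun j => (f j : ℤ) + (g j : ℤ) + xiSeq f g e1 e2 d j

/-- Decrease the first `k` parts of `μ` by 2. -/
def stripTwo (μ : ℕ → ℕ) (k : ℕ) : ℕ → ℕ := fun j => if j < k then μ j - 2 else μ j

/-- The partition `(k,k)` with two parts equal to `k`. -/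
def twoParts (k : ℕ) : ℕ → ℕ := fun j => if j < 2 then k else 0

theorem ptrans_eq_of_forall {f : ℕ → ℕ} {v n : ℕ} (h : ∀ j, j < n ↔ v < f j) :
    ptrans f v = n := by
  unfold ptrans
  have hiff : ∀ i, v + 1 ≤ f i ↔ i < n := fun i => by rw [h]; omega
  rw [Nat.card_congr (Equiv.subtypeEquivRight hiff)]
  have : Nat.card {i // i < n} = Nat.card (Fin n) :=
    Nat.card_congr Fin.equivSubtype.symm
  rw [this, Nat.card_fin]

theorem lt_ptrans_iff {f : ℕ → ℕ} (hf : Antitone f) {M : ℕ} (hM : ∀ j, M ≤ j → f j = 0)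
    (j v : ℕ) : j < ptrans f v ↔ v < f j := by
  classical
  have hex : ∃ n, f n ≤ v := ⟨M, by simp [hM M le_rfl]⟩
  have hiff : ∀ i, i < Nat.find hex ↔ v < f i := by
    intro i
    rw [Nat.lt_find_iff]
    constructor
    · intro h
      have := h i le_rfl
      omega
    · intro h l hl
      have := hf hl
      omega
  rw [ptrans_eq_of_forall hiff, hiff]

theorem ptrans_antitone {f : ℕ → ℕ} (hf : Antitone f) {M : ℕ} (hM : ∀ j, M ≤ j → f j = 0) :
    Antitone (ptrans f) := by
  intro v w hvw
  by_contra! h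
  rw [lt_ptrans_iff hf hM] at h
  have := (lt_ptrans_iff hf hM (ptrans f v) v).2 (by omega)
  omega

theorem ptrans_eq_zero {f : ℕ → ℕ} (hf : Antitone f) {M : ℕ} (hM : ∀ j, M ≤ j → f j = 0)
    {v : ℕ} (hv : f 0 ≤ v) : ptrans f v = 0 := by
  by_contra! h
  have := (lt_ptrans_iff hf hM 0 v).1 (by omega)
  omega

theorem ptrans_ptrans {f : ℕ → ℕ} (hf : Antitone f) {M : ℕ} (hM : ∀ j, M ≤ j → f j = 0) :
    ptrans (ptrans f) = f := by
  funext j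
  exact ptrans_eq_of_forall fun v => (lt_ptrans_iff hf hM j v).symm

theorem pmult_add_ptrans {f : ℕ → ℕ} (hf : Antitone f) {M : ℕ} (hM : ∀ j, M ≤ j → f j = 0)
    (v : ℕ) : pmult f (v + 1) + ptrans f (v + 1) = ptrans f v := by
  have hiff : ∀ i, f i = v + 1 ↔ i ∈ Finset.Ico (ptrans f (v + 1)) (ptrans f v) := by
    intro i
    have h1 := lt_ptrans_iff hf hM i v
    have h2 := lt_ptrans_iff hf hM i (v + 1)
    rw [Finset.mem_Ico]
    omega
  have hle := ptrans_antitone hf hM (Nat.le_succ v)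
  have hcard : pmult f (v + 1) = ptrans f v - ptrans f (v + 1) := by
    unfold pmult
    rw [Nat.card_congr (Equiv.subtypeEquivRight hiff), Nat.card_eq_fintype_card,
      Fintype.card_coe, Nat.card_Ico]
  simp only [Nat.succ_eq_add_one] at hle
  omega

theorem sum_ptrans {f : ℕ → ℕ} (hf : Antitone f) {M : ℕ} (hM : ∀ j, M ≤ j → f j = 0) :
    ∑ v ∈ Finset.range (f 0), ptrans f v = ∑ j ∈ Finset.range M, f j := by
  have hrow : ∀ j ∈ Finset.range M,
      f j = ∑ v ∈ Finset.range (f 0), if v < f j then 1 else 0 := by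
    intro j _
    rw [← Finset.card_filter]
    have : (Finset.range (f 0)).filter (fun v => v < f j) = Finset.range (f j) := by
      ext v
      have := hf (Nat.zero_le j)
      simp only [Finset.mem_filter, Finset.mem_range]
      omega
    rw [this, Finset.card_range]
  have hcol : ∀ v ∈ Finset.range (f 0),
      ptrans f v = ∑ j ∈ Finset.range M, if v < f j then 1 else 0 := by
    intro v _
    rw [← Finset.card_filter]
    have : (Finset.range M).filter (fun j => v < f j) = Finset.range (ptrans f v) := by
      ext j
      have h1 := lt_ptrans_iff hf hM j v
      have h2 := hM j
      simp only [Finset.mem_filter, Finset.mem_range]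
      omega
    rw [this, Finset.card_range]
  rw [Finset.sum_congr rfl hrow, Finset.sum_congr rfl hcol, Finset.sum_comm]

theorem isPartitionOf_ptrans {f : ℕ → ℕ} {d : ℕ} (h : IsPartitionOf f d) :
    IsPartitionOf (ptrans f) d := by
  obtain ⟨hf, M, hM, hs⟩ := h
  exact ⟨ptrans_antitone hf hM, f 0, fun v hv => ptrans_eq_zero hf hM hv,
    (sum_ptrans hf hM).trans hs⟩

theorem sum_plusOne (f : ℕ → ℕ) (N : ℕ) :
    ∑ j ∈ Finset.range (N + 1), plusOne f j = ∑ j ∈ Finset.range (N + 1), f j + 1 := by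
  rw [Finset.sum_range_succ', Finset.sum_range_succ']
  simp [plusOne]
  omega

theorem plusOne_antitone {f : ℕ → ℕ} (hf : Antitone f) : Antitone (plusOne f) := by
  intro i j hij
  have := hf hij
  unfold plusOne
  split_ifs <;> grind

theorem isPartitionOf_plusOne {f : ℕ → ℕ} {d : ℕ} (h : IsPartitionOf f d) :
    IsPartitionOf (plusOne f) (d + 1) := by
  obtain ⟨hf, M, hM, hs⟩ := h
  refine ⟨plusOne_antitone hf, M + 1, fun j hj => ?_, ?_⟩
  · have := hM j (by omega)
    simp only [plusOne]
    split_ifs <;> omega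
  · rw [sum_plusOne, Finset.sum_range_succ, hM M le_rfl, hs, add_zero]

/-- The amount by which the `N`-th partial sum of `f` drops under the B-collapse. -/
def collapseDefect (f : ℕ → ℕ) (N : ℕ) : ℕ :=
  if Odd (∑ j ∈ Finset.range N, f j + N) ∧ ¬ (f (N - 1) = f N ∧ Even (f N)) then 1 else 0

/-- Explicit formula for the B-collapse of `f`. -/
def orthCollapse (f : ℕ → ℕ) (j : ℕ) : ℕ :=
  f j + collapseDefect f j - collapseDefect f (j + 1)

theorem collapseDefect_zero (f : ℕ → ℕ) : collapseDefect f 0 = 0 := by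
  simp [collapseDefect]

theorem sum_range_eq_of_const {f : ℕ → ℕ} {a v : ℕ} (n : ℕ)
    (h : ∀ j, a ≤ j → j < a + n → f j = v) :
    ∑ j ∈ Finset.range (a + n), f j = ∑ j ∈ Finset.range a, f j + n * v := by
  induction n with
  | zero => simp
  | succ n ih =>
    rw [← add_assoc, Finset.sum_range_succ, ih fun j h1 h2 => h j h1 (by omega),
      h (a + n) (by omega) (by omega)]
    ring

theorem sum_range_ptrans {f : ℕ → ℕ} (hf : Antitone f) {M : ℕ} (hM : ∀ j, M ≤ j → f j = 0)
    (v : ℕ) : ∑ j ∈ Finset.range (ptrans f v), f j =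
      ∑ j ∈ Finset.range (ptrans f (v + 1)), f j + pmult f (v + 1) * (v + 1) := by
  rw [← pmult_add_ptrans hf hM v, add_comm (pmult f (v + 1))]
  apply sum_range_eq_of_const
  intro j h1 h2
  rw [add_comm, pmult_add_ptrans hf hM v, lt_ptrans_iff hf hM] at h2
  have := lt_ptrans_iff hf hM j (v + 1)
  omega

theorem isOrthogonal_iff_even {f : ℕ → ℕ} (hf : Antitone f) {M : ℕ}
    (hM : ∀ j, M ≤ j → f j = 0) :
    IsOrthogonal f ↔
      ∀ v, Even (∑ j ∈ Finset.range (ptrans f v), f j + ptrans f v) := by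
  constructor
  · intro h
    have key : ∀ n v, v + n = f 0 →
        Even (∑ j ∈ Finset.range (ptrans f v), f j + ptrans f v) := by
      intro n
      induction n with
      | zero =>
        intro v hv
        simp [ptrans_eq_zero hf hM (v := v) (by omega)]
      | succ n ih =>
        intro v hv
        have h1 := ih (v + 1) (by omega)
        rw [sum_range_ptrans hf hM v]
        have h2 := pmult_add_ptrans hf hM v
        have h3 := h (v + 1) (by omega)
        rw [← h2]
        grind
    intro v
    by_cases hv : f 0 ≤ v
    · simp [ptrans_eq_zero hf hM hv]
    · exact key (f 0 - v) v (by omega)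
  · intro h k hk hke
    obtain ⟨v, rfl⟩ : ∃ v, k = v + 1 := ⟨k - 1, by omega⟩
    have h1 := h v
    rw [sum_range_ptrans hf hM v, ← pmult_add_ptrans hf hM v] at h1
    have h2 := h (v + 1)
    grind

theorem isOrthogonal_iff {f : ℕ → ℕ} (hf : Antitone f) {M : ℕ}
    (hM : ∀ j, M ≤ j → f j = 0) :
    IsOrthogonal f ↔
      ∀ N, Odd (∑ j ∈ Finset.range N, f j + N) → f (N - 1) = f N ∧ Even (f N) := by
  rw [isOrthogonal_iff_even hf hM]
  constructor
  · intro h N hN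
    have hle : ptrans f (f N) ≤ N := by
      by_contra! hlt
      rw [lt_ptrans_iff hf hM] at hlt
      omega
    obtain ⟨n, hn⟩ := Nat.exists_eq_add_of_le hle
    have hsum : ∑ j ∈ Finset.range N, f j
        = ∑ j ∈ Finset.range (ptrans f (f N)), f j + n * f N := by
      conv_lhs => rw [hn]
      apply sum_range_eq_of_const
      intro j h1 h2
      have h3 := lt_ptrans_iff hf hM j (f N)
      have h4 : f N ≤ f j := hf (by omega)
      omega
    have h0 := h (f N)
    rw [hsum] at hN
    have hn0 : n ≠ 0 := by
      rintro rfl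
      have : N = ptrans f (f N) := by omega
      rw [← this] at h0 hN
      grind
    constructor
    · have h3 := lt_ptrans_iff hf hM (N - 1) (f N)
      have h4 : f N ≤ f (N - 1) := hf (by omega)
      omega
    · by_contra hodd
      rw [Nat.not_even_iff_odd] at hodd
      have : Odd (∑ j ∈ Finset.range (ptrans f (f N)), f j + ptrans f (f N) + n * (f N + 1)) := by
        convert hN using 1
        rw [mul_add]
        omega
      grind
  · intro h v
    by_contra hodd
    rw [Nat.not_even_iff_odd] at hodd
    have h1 := (h _ hodd).1
    have h0 : ptrans f v ≠ 0 := by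
      intro h0
      simp [h0] at hodd
    have h2 := lt_ptrans_iff hf hM (ptrans f v - 1) v
    have h3 := lt_ptrans_iff hf hM (ptrans f v) v
    omega

theorem collapseDefect_succ_le {f : ℕ → ℕ} (hf : Antitone f) (j : ℕ) :
    collapseDefect f (j + 1) ≤ f j + collapseDefect f j := by
  have := hf (Nat.le_succ j)
  unfold collapseDefect
  simp only [Nat.succ_eq_add_one, Nat.add_sub_cancel] at *
  split_ifs with h1 h2 <;> grind

theorem orthCollapse_add {f : ℕ → ℕ} (hf : Antitone f) (j : ℕ) :
    orthCollapse f j + collapseDefect f (j + 1) = f j + collapseDefect f j :=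
  Nat.sub_add_cancel (collapseDefect_succ_le hf j)

theorem sum_orthCollapse {f : ℕ → ℕ} (hf : Antitone f) (N : ℕ) :
    ∑ j ∈ Finset.range N, orthCollapse f j + collapseDefect f N
      = ∑ j ∈ Finset.range N, f j := by
  induction N with
  | zero => simp [collapseDefect_zero]
  | succ N ih =>
    rw [Finset.sum_range_succ, Finset.sum_range_succ]
    have := orthCollapse_add hf N
    omega

theorem orthCollapse_antitone {f : ℕ → ℕ} (hf : Antitone f) : Antitone (orthCollapse f) := by
  refine antitone_nat_of_succ_le fun N => ?_
  have h1 := orthCollapse_add hf N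
  have h2 := orthCollapse_add hf (N + 1)
  suffices f (N + 1) + 2 * collapseDefect f (N + 1)
      ≤ f N + collapseDefect f N + collapseDefect f (N + 2) by
    rw [show N + 1 + 1 = N + 2 from rfl] at h2
    omega
  have hN := hf (Nat.le_succ N)
  have hs1 := Finset.sum_range_succ f N
  have hs2 := Finset.sum_range_succ f (N + 1)
  unfold collapseDefect
  rw [show N + 1 + 1 = N + 2 from rfl] at hs2
  simp only [Nat.succ_eq_add_one, Nat.add_sub_cancel, show N + 2 - 1 = N + 1 from rfl] at *
  rw [hs2, hs1]
  simp only [Nat.odd_iff, Nat.even_iff]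
  generalize ∑ j ∈ Finset.range N, f j = S
  generalize f (N - 1) = w
  split_ifs <;> omega

theorem collapseDefect_of_zero {f : ℕ → ℕ} {N : ℕ} (h1 : f (N - 1) = 0) (h2 : f N = 0) :
    collapseDefect f N = 0 := by
  simp [collapseDefect, h1, h2]

theorem orthCollapse_eq_zero {f : ℕ → ℕ} {M : ℕ} (hM : ∀ j, M ≤ j → f j = 0) {j : ℕ}
    (hj : M + 1 ≤ j) : orthCollapse f j = 0 := by
  have h1 := collapseDefect_of_zero (hM (j - 1) (by omega)) (hM j (by omega))
  simp [orthCollapse, h1, hM j (by omega)]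

theorem isPartitionOf_orthCollapse {f : ℕ → ℕ} {d : ℕ} (h : IsPartitionOf f d) :
    IsPartitionOf (orthCollapse f) d := by
  obtain ⟨hf, M, hM, hs⟩ := h
  refine ⟨orthCollapse_antitone hf, M + 1, fun j hj => orthCollapse_eq_zero hM hj, ?_⟩
  have h1 := sum_orthCollapse hf (M + 1)
  rw [collapseDefect_of_zero (hM _ (by omega)) (hM _ (by omega)), Finset.sum_range_succ f,
    hM M le_rfl] at h1
  omega

theorem isOrthogonal_orthCollapse {f : ℕ → ℕ} {d : ℕ} (h : IsPartitionOf f d) :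
    IsOrthogonal (orthCollapse f) := by
  have ⟨hf, M, hM, _⟩ := h
  rw [isOrthogonal_iff (orthCollapse_antitone hf) fun j hj => orthCollapse_eq_zero hM hj]
  rintro (_ | N) hN
  · simp at hN
  have h0 := sum_orthCollapse hf (N + 1)
  have h1 := orthCollapse_add hf N
  have h2 := orthCollapse_add hf (N + 1)
  have hs1 := Finset.sum_range_succ f N
  have hs2 := Finset.sum_range_succ f (N + 1)
  unfold collapseDefect at h0 h1 h2
  rw [show N + 1 + 1 = N + 2 from rfl] at hs2 h2
  simp only [Nat.add_sub_cancel, show N + 2 - 1 = N + 1 from rfl] at *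
  rw [hs2] at h2
  rw [hs1] at h0 h1 h2
  simp only [Nat.odd_iff, Nat.even_iff] at *
  generalize ∑ j ∈ Finset.range N, f j = S at *
  generalize ∑ j ∈ Finset.range (N + 1), orthCollapse f j = S' at *
  generalize f (N - 1) = w at *
  split_ifs at h0 h1 h2 <;> omega

theorem sum_add_collapseDefect_le {f g : ℕ → ℕ} {d : ℕ} (hf : Antitone f)
    (hg : IsPartitionOf g d)
    (hgo : IsOrthogonal g) (hle : NDomLE g f) (N : ℕ) :
    ∑ j ∈ Finset.range N, g j + collapseDefect f N ≤ ∑ j ∈ Finset.range N, f j := by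
  obtain ⟨hga, M, hM, _⟩ := hg
  rw [isOrthogonal_iff hga hM] at hgo
  have h1 := hle N
  unfold collapseDefect
  split_ifs with hc
  swap
  · simpa using h1
  by_contra! hlt
  obtain _ | N := N
  · simp at hc
  have heq : ∑ j ∈ Finset.range (N + 1), g j = ∑ j ∈ Finset.range (N + 1), f j := by omega
  have h2 := hgo (N + 1) (by rw [heq]; exact hc.1)
  have h3 := hle N
  have h4 := hle (N + 2)
  rw [Finset.sum_range_succ, Finset.sum_range_succ f] at heq
  rw [Finset.sum_range_succ, Finset.sum_range_succ f, Finset.sum_range_succ,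
    Finset.sum_range_succ f] at h4
  have h5 := hf (Nat.le_succ N)
  simp only [Nat.add_sub_cancel, Nat.succ_eq_add_one] at *
  rw [Nat.even_iff] at hc h2
  omega

theorem eq_of_sum_range_eq {f g : ℕ → ℕ}
    (h : ∀ N, ∑ j ∈ Finset.range N, f j = ∑ j ∈ Finset.range N, g j) : f = g := by
  funext j
  have h1 := h (j + 1)
  rw [Finset.sum_range_succ, Finset.sum_range_succ, h j] at h1
  omega

theorem eq_orthCollapse {f g : ℕ → ℕ} {d : ℕ} (hf : IsPartitionOf f d)
    (h : IsBCollapse d f g) : g = orthCollapse f := by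
  obtain ⟨hg, hgo, hle, hmax⟩ := h
  apply eq_of_sum_range_eq
  intro N
  have h1 := hmax _ (isPartitionOf_orthCollapse hf) (isOrthogonal_orthCollapse hf)
    (fun N => by have := sum_orthCollapse hf.1 N; omega) N
  have h2 := sum_add_collapseDefect_le hf.1 hg hgo hle N
  have h3 := sum_orthCollapse hf.1 N
  omega

/-- Insert two copies of `k` into `f` at position `p`. -/
def insertPair (f : ℕ → ℕ) (p k : ℕ) : ℕ → ℕ :=
  fun j => if j < p then f j else if j < p + 2 then k else f (j - 2)

section InsertPair

variable {f : ℕ → ℕ} {p k : ℕ}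

theorem insertPair_of_lt {j : ℕ} (h : j < p) : insertPair f p k j = f j := if_pos h

theorem insertPair_self : insertPair f p k p = k := by simp [insertPair]

theorem insertPair_succ : insertPair f p k (p + 1) = k := by simp [insertPair]

theorem insertPair_add_two {j : ℕ} (h : p ≤ j) : insertPair f p k (j + 2) = f j := by
  unfold insertPair
  rw [if_neg (by omega), if_neg (by omega)]
  rfl

theorem insertPair_antitone (hf : Antitone f) (h1 : ∀ j, j < p → k ≤ f j) (h2 : f p ≤ k) :
    Antitone (insertPair f p k) := by
  intro i j hij
  have h3 : i - 2 ≤ j - 2 := by omega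
  have := hf hij
  have := hf h3
  unfold insertPair
  split_ifs with a b c d e
  all_goals first
    | omega
    | (have := h1 i (by omega); have := hf (show p ≤ j - 2 by omega); omega)
    | (have := h1 i (by omega); omega)
    | (have := hf (show p ≤ j - 2 by omega); omega)

theorem sum_insertPair_of_le {N : ℕ} (h : N ≤ p) :
    ∑ j ∈ Finset.range N, insertPair f p k j = ∑ j ∈ Finset.range N, f j :=
  Finset.sum_congr rfl fun j hj => insertPair_of_lt (by rw [Finset.mem_range] at hj; omega)

theorem sum_insertPair_succ :
    ∑ j ∈ Finset.range (p + 1), insertPair f p k j = ∑ j ∈ Finset.range p, f j + k := by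
  rw [Finset.sum_range_succ, sum_insertPair_of_le le_rfl, insertPair_self]

theorem sum_insertPair_add_two {N : ℕ} (h : p ≤ N) :
    ∑ j ∈ Finset.range (N + 2), insertPair f p k j
      = ∑ j ∈ Finset.range N, f j + 2 * k := by
  induction N, h using Nat.le_induction with
  | base =>
    rw [Finset.sum_range_succ, sum_insertPair_succ, insertPair_succ]
    ring
  | succ N h ih =>
    rw [show N + 1 + 2 = N + 2 + 1 from rfl, Finset.sum_range_succ, ih, insertPair_add_two h,
      Finset.sum_range_succ]
    ring

theorem collapseDefect_insertPair_of_le (hk : Odd k) (h1 : ∀ j, j < p → k ≤ f j)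
    (h2 : f p ≤ k) {N : ℕ} (hN : N ≤ p) :
    collapseDefect (insertPair f p k) N = collapseDefect f N := by
  unfold collapseDefect
  rw [sum_insertPair_of_le hN]
  obtain rfl | hN := hN.eq_or_lt
  · obtain _ | q := N
    · simp
    · rw [insertPair_self, insertPair_of_lt (by omega)]
      have := h1 q (by omega)
      simp only [Nat.add_sub_cancel] at *
      grind
  · rw [insertPair_of_lt hN, insertPair_of_lt (show N - 1 < p by omega)]

theorem collapseDefect_insertPair_succ (hk : Odd k) (h1 : ∀ j, j < p → k ≤ f j)
    (h2 : f p ≤ k) :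
    collapseDefect (insertPair f p k) (p + 1) = collapseDefect f p := by
  unfold collapseDefect
  rw [sum_insertPair_succ, insertPair_succ, Nat.add_sub_cancel, insertPair_self]
  have h3 := h1 (p - 1)
  obtain _ | q := p
  · simp
    grind
  · simp only [Nat.add_sub_cancel] at *
    grind

theorem collapseDefect_insertPair_add_two (hk : Odd k) (h1 : ∀ j, j < p → k ≤ f j)
    (h2 : f p ≤ k) {N : ℕ} (hN : p ≤ N) :
    collapseDefect (insertPair f p k) (N + 2) = collapseDefect f N := by
  unfold collapseDefect
  rw [sum_insertPair_add_two hN, insertPair_add_two hN]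
  obtain rfl | hN := hN.eq_or_lt
  · rw [show p + 2 - 1 = p + 1 from rfl, insertPair_succ]
    have h3 := h1 (p - 1)
    obtain _ | q := p
    · simp
      grind
    · simp only [Nat.add_sub_cancel] at *
      grind
  · rw [show N + 2 - 1 = (N - 1) + 2 by omega, insertPair_add_two (by omega)]
    grind

theorem orthCollapse_insertPair (hk : Odd k) (h1 : ∀ j, j < p → k ≤ f j) (h2 : f p ≤ k) :
    orthCollapse (insertPair f p k) = insertPair (orthCollapse f) p k := by
  funext j
  rcases lt_or_ge j p with hj | hj
  · rw [insertPair_of_lt hj]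
    unfold orthCollapse
    rw [insertPair_of_lt hj, collapseDefect_insertPair_of_le hk h1 h2 (by omega),
      collapseDefect_insertPair_of_le hk h1 h2 (by omega)]
  obtain rfl | hj := hj.eq_or_lt
  · rw [insertPair_self]
    unfold orthCollapse
    rw [insertPair_self, collapseDefect_insertPair_of_le hk h1 h2 le_rfl,
      collapseDefect_insertPair_succ hk h1 h2, Nat.add_sub_cancel]
  obtain rfl | hj := (Nat.succ_le_of_lt hj).eq_or_lt
  · rw [Nat.succ_eq_add_one, insertPair_succ]
    unfold orthCollapse
    rw [insertPair_succ, collapseDefect_insertPair_add_two hk h1 h2 le_rfl,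
      collapseDefect_insertPair_succ hk h1 h2, Nat.add_sub_cancel]
  · obtain ⟨i, rfl⟩ : ∃ i, j = i + 2 := ⟨j - 2, by omega⟩
    rw [insertPair_add_two (by omega)]
    unfold orthCollapse
    rw [insertPair_add_two (by omega), collapseDefect_insertPair_add_two hk h1 h2 (by omega),
      show i + 2 + 1 = i + 1 + 2 from rfl,
      collapseDefect_insertPair_add_two hk h1 h2 (by omega)]

theorem ptrans_insertPair (hf : Antitone f) {M : ℕ} (hM : ∀ j, M ≤ j → f j = 0)
    (h1 : ∀ j, j < p → k ≤ f j) (h2 : f p ≤ k) (v : ℕ) :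
    ptrans (insertPair f p k) v = ptrans f v + if v < k then 2 else 0 := by
  apply ptrans_eq_of_forall
  intro j
  have h3 := lt_ptrans_iff hf hM p v
  have h4 := lt_ptrans_iff hf hM (p - 1) v
  have h5 := lt_ptrans_iff hf hM j v
  have h6 := lt_ptrans_iff hf hM (j - 2) v
  have h7 := h1 (p - 1)
  have h8 := h1 j
  unfold insertPair
  split_ifs <;> omega

theorem ptrans_twoParts (v : ℕ) : ptrans (twoParts k) v = if v < k then 2 else 0 := by
  apply ptrans_eq_of_forall
  intro j
  unfold twoParts
  split_ifs <;> omega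

theorem isUnionOf_insertPair (hf : Antitone f) {M : ℕ} (hM : ∀ j, M ≤ j → f j = 0)
    (h1 : ∀ j, j < p → k ≤ f j) (h2 : f p ≤ k) :
    IsUnionOf (insertPair f p k) f (twoParts k) := by
  have hanti := insertPair_antitone hf h1 h2
  have hzero : ∀ j, M + p + 2 ≤ j → insertPair f p k j = 0 := by
    intro j hj
    obtain ⟨i, rfl⟩ : ∃ i, j = i + 2 := ⟨j - 2, by omega⟩
    rw [insertPair_add_two (by omega), hM i (by omega)]
  refine ⟨hanti, ⟨_, hzero⟩, fun v hv => ?_⟩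
  obtain ⟨w, rfl⟩ : ∃ w, v = w + 1 := ⟨v - 1, by omega⟩
  have h3 := pmult_add_ptrans hanti hzero w
  have h4 := pmult_add_ptrans hf hM w
  have htwo : Antitone (twoParts k) := by
    intro i j hij
    unfold twoParts
    split_ifs <;> omega
  have h5 := pmult_add_ptrans htwo (M := 2)
    (fun j hj => by simp [twoParts]; omega) w
  rw [ptrans_insertPair hf hM h1 h2, ptrans_insertPair hf hM h1 h2] at h3
  rw [ptrans_twoParts, ptrans_twoParts] at h5
  omega

end InsertPair

theorem orthCollapse_bounds {f : ℕ → ℕ} {p k : ℕ} (hf : Antitone f) (hk : Odd k)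
    (h1 : ∀ j, j < p → k ≤ f j) (h2 : f p ≤ k) :
    (∀ j, j < p → k ≤ orthCollapse f j) ∧ orthCollapse f p ≤ k := by
  have h := orthCollapse_antitone (insertPair_antitone hf h1 h2)
  rw [orthCollapse_insertPair hk h1 h2] at h
  constructor
  · intro j hj
    have := h hj.le
    rwa [insertPair_of_lt hj, insertPair_self] at this
  · have := h (show p + 1 ≤ p + 2 by omega)
    rwa [insertPair_succ, insertPair_add_two le_rfl] at this

/-- Raising the first of two leading copies of an odd `k` instead of the next part does not
change the B-collapse. -/
theorem orthCollapse_plusOne_insertPair_zero {f : ℕ → ℕ} {k : ℕ} (hf : Antitone f)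
    (hk : Odd k) (h : f 0 < k) :
    orthCollapse (plusOne (insertPair f 0 k)) = orthCollapse (insertPair (plusOne f) 0 k) := by
  have hb := plusOne_antitone (insertPair_antitone hf (p := 0) (by simp) h.le)
  have hc := insertPair_antitone (plusOne_antitone hf) (p := 0) (k := k) (by simp)
    (by simp [plusOne]; omega)
  apply eq_of_sum_range_eq
  intro N
  have e1 := sum_orthCollapse hb N
  have e2 := sum_orthCollapse hc N
  suffices ∑ j ∈ Finset.range N, plusOne (insertPair f 0 k) j
        + collapseDefect (insertPair (plusOne f) 0 k) N
      = ∑ j ∈ Finset.range N, insertPair (plusOne f) 0 k j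
        + collapseDefect (plusOne (insertPair f 0 k)) N by omega
  clear e1 e2
  rcases N with _ | _ | _ | N
  · simp [collapseDefect_zero]
  · simp [collapseDefect, plusOne, insertPair]
    grind
  · simp [collapseDefect, plusOne, insertPair, Finset.sum_range_succ]
    grind
  · have hs : ∑ j ∈ Finset.range (N + 3), plusOne (insertPair f 0 k) j
        = ∑ j ∈ Finset.range (N + 3), insertPair (plusOne f) 0 k j := by
      rw [sum_plusOne, show N + 2 + 1 = N + 1 + 2 from rfl, sum_insertPair_add_two (by omega),
        sum_insertPair_add_two (by omega), sum_plusOne]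
      ring
    have hd : collapseDefect (plusOne (insertPair f 0 k)) (N + 3)
        = collapseDefect (insertPair (plusOne f) 0 k) (N + 3) := by
      unfold collapseDefect
      rw [hs]
      rcases N with _ | N
      · have := hf (Nat.zero_le 1)
        simp [plusOne, insertPair, Finset.sum_range_succ]
        grind
      · simp [plusOne, insertPair]
    rw [← show N + 3 = N + 1 + 1 + 1 from rfl, hs, hd]

theorem plusOne_insertPair {f : ℕ → ℕ} {p k : ℕ} (hp : 0 < p) :
    plusOne (insertPair f p k) = insertPair (plusOne f) p k := by
  funext j
  unfold plusOne insertPair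
  split_ifs <;> grind

theorem stripTwo_isPartitionOf {μ : ℕ → ℕ} {d k : ℕ} (hk : 0 < k) (hμ : IsPartitionOf μ d)
    (hstep : μ k + 2 ≤ μ (k - 1)) :
    2 * k ≤ d ∧ IsPartitionOf (stripTwo μ k) (d - 2 * k) := by
  obtain ⟨ha, M, hM, hs⟩ := hμ
  have hge : ∀ j, j < k → μ k + 2 ≤ μ j := fun j hj =>
    hstep.trans (ha (by omega))
  have hkM : k ≤ M := by
    by_contra! h
    have := hM (k - 1) (by omega)
    omega
  have hsum : ∑ j ∈ Finset.range M, stripTwo μ k j + 2 * k = d := by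
    obtain ⟨n, rfl⟩ := Nat.exists_eq_add_of_le hkM
    rw [Finset.sum_range_add] at hs ⊢
    have h1 : ∑ j ∈ Finset.range k, stripTwo μ k j + 2 * k = ∑ j ∈ Finset.range k, μ j := by
      have : 2 * k = ∑ j ∈ Finset.range k, 2 := by simp [mul_comm]
      rw [this, ← Finset.sum_add_distrib]
      refine Finset.sum_congr rfl fun j hj => ?_
      rw [Finset.mem_range] at hj
      have := hge j hj
      rw [stripTwo, if_pos hj]
      omega
    have h2 : ∑ j ∈ Finset.range n, stripTwo μ k (k + j) = ∑ j ∈ Finset.range n, μ (k + j) :=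
      Finset.sum_congr rfl fun j _ => if_neg (by omega)
    omega
  refine ⟨by omega, ?_, M, fun j hj => ?_, by omega⟩
  · intro i j hij
    have h1 := ha hij
    have h2 := hge i
    have h3 : k ≤ j → μ j ≤ μ k := fun h => ha h
    unfold stripTwo
    split_ifs <;> omega
  · rw [stripTwo, hM j hj]
    simp

theorem ptrans_eq_insertPair {μ : ℕ → ℕ} {d k : ℕ} (hk : 0 < k) (hμ : IsPartitionOf μ d)
    (hstep : μ k + 2 ≤ μ (k - 1)) :
    ptrans μ = insertPair (ptrans (stripTwo μ k)) (μ (k - 1) - 2) k := by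
  obtain ⟨hνa, L, hL, _⟩ := (stripTwo_isPartitionOf hk hμ hstep).2
  obtain ⟨ha, M, hM, _⟩ := hμ
  funext v
  apply ptrans_eq_of_forall
  intro j
  have h1 := lt_ptrans_iff hνa hL j v
  have h2 := lt_ptrans_iff hνa hL j (v - 2)
  have h3 : j < k → μ (k - 1) ≤ μ j := fun h => ha (by omega)
  have h4 : k ≤ j → μ j ≤ μ k := fun h => ha h
  have h5 : stripTwo μ k j = if j < k then μ j - 2 else μ j := rfl
  rw [h5] at h1 h2
  unfold insertPair
  split_ifs at * <;> omega

theorem stripTwo_isSymplectic {μ : ℕ → ℕ} {d k : ℕ} (hk : 0 < k) (hμ : IsPartitionOf μ d)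
    (hμs : IsSymplectic μ) (hstep : μ k + 2 ≤ μ (k - 1)) : IsSymplectic (stripTwo μ k) := by
  have hins := ptrans_eq_insertPair hk hμ hstep
  obtain ⟨hνa, L, hL, _⟩ := (stripTwo_isPartitionOf hk hμ hstep).2
  obtain ⟨ha, M, hM, _⟩ := hμ
  intro v hv hvo
  obtain ⟨w, rfl⟩ : ∃ w, v = w + 1 := ⟨v - 1, by omega⟩
  have h0 := pmult_add_ptrans hνa hL w
  have e1 := pmult_add_ptrans ha hM w
  have e2 := pmult_add_ptrans ha hM (w + 1)
  have e3 := pmult_add_ptrans ha hM (w + 2)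
  have s1 := hμs (w + 1) (by omega) hvo
  have s3 := hμs (w + 3) (by omega) (by grind)
  rw [hins] at e1 e2 e3
  set A := μ (k - 1) - 2
  rcases lt_trichotomy (w + 1) A with h | h | h
  · rw [insertPair_of_lt h, insertPair_of_lt (by omega)] at e1
    grind
  · rw [show w + 1 + 1 = A + 1 by omega, h, insertPair_succ, insertPair_self] at e2
    rw [h, insertPair_self, insertPair_of_lt (by omega)] at e1
    rw [show w + 2 + 1 = w + 1 + 2 from rfl, insertPair_add_two (by omega),
      show w + 2 = A + 1 by omega, insertPair_succ] at e3
    grind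
  · rw [show w + 1 + 1 = w + 2 from rfl, show w + 2 + 1 = w + 1 + 2 from rfl] at e3
    rw [insertPair_add_two (by omega), insertPair_add_two (by omega)] at e3
    grind

theorem isSymplectic_ptrans_iff {f : ℕ → ℕ} {d : ℕ} (h : IsPartitionOf f d) :
    IsSymplectic (ptrans f) ↔ ∀ w, Even w → Even (f w - f (w + 1)) := by
  have ⟨_, L, hL, _⟩ := isPartitionOf_ptrans h
  obtain ⟨hf, M, hM, _⟩ := h
  have key : ∀ w, pmult (ptrans f) (w + 1) = f w - f (w + 1) := by
    intro w
    have := pmult_add_ptrans (ptrans_antitone hf hM) hL w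
    rw [ptrans_ptrans hf hM] at this
    omega
  constructor
  · intro hs w hw
    rw [← key]
    exact hs _ (by omega) (by grind)
  · intro hs v hv hvo
    obtain ⟨w, rfl⟩ : ∃ w, v = w + 1 := ⟨v - 1, by omega⟩
    rw [key]
    exact hs w (by grind)

theorem stripTwo_isSymplectic_ptrans {μ : ℕ → ℕ} {d k : ℕ} (hk : 0 < k)
    (hμ : IsPartitionOf μ d) (hstep : μ k + 2 ≤ μ (k - 1)) (hs : IsSymplectic (ptrans μ)) :
    IsSymplectic (ptrans (stripTwo μ k)) := by
  rw [isSymplectic_ptrans_iff (stripTwo_isPartitionOf hk hμ hstep).2]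
  rw [isSymplectic_ptrans_iff hμ] at hs
  intro w hw
  have h1 := hs w hw
  have h2 : w < k → μ (k - 1) ≤ μ w := fun h => hμ.1 (by omega)
  have h3 : w + 1 < k → μ (k - 1) ≤ μ (w + 1) := fun h => hμ.1 (by omega)
  unfold stripTwo
  rw [Nat.even_iff] at h1 ⊢
  by_cases hwk : w + 1 = k
  · subst hwk
    simp only [Nat.add_sub_cancel] at *
    split_ifs <;> omega
  · split_ifs <;> omega

/-- `μ` symplectic partition of `2m`, `k > 0` odd with
`μ_k ≥ μ_{k+1}+2` (1-based).  Let `ν` be `μ` with the first `k` parts decreased by 2.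
Then `ν` is a symplectic partition of `2(m−k)`; if `μ` is special so is `ν`; and if
`σ, τ` are B-collapses of `(νᵗ)⁺, (μᵗ)⁺` then `τ = σ ∪ (k,k)`. -/
theorem stmt13 (m k : ℕ) (μ : ℕ → ℕ) (hk : 0 < k) (hko : Odd k)
    (hμ : IsPartitionOf μ (2*m)) (hμs : IsSymplectic μ)
    (hstep : μ k + 2 ≤ μ (k-1)) :
    (IsPartitionOf (stripTwo μ k) (2*(m-k)) ∧ IsSymplectic (stripTwo μ k)) ∧
    (IsSymplectic (ptrans μ) → IsSymplectic (ptrans (stripTwo μ k))) ∧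
    ∀ σ τ : ℕ → ℕ,
      IsBCollapse (2*(m-k)+1) (plusOne (ptrans (stripTwo μ k))) σ →
      IsBCollapse (2*m+1) (plusOne (ptrans μ)) τ →
      IsUnionOf τ σ (twoParts k) := by
  obtain ⟨hle, hν⟩ := stripTwo_isPartitionOf hk hμ hstep
  rw [← Nat.mul_sub] at hν
  refine ⟨⟨hν, stripTwo_isSymplectic hk hμ hμs hstep⟩,
    stripTwo_isSymplectic_ptrans hk hμ hstep, fun σ τ hσ hτ => ?_⟩
  have hσP := hσ.1
  have hνt := isPartitionOf_ptrans hν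
  have ha := isPartitionOf_plusOne hνt
  obtain rfl := eq_orthCollapse ha hσ
  obtain rfl := eq_orthCollapse (isPartitionOf_plusOne (isPartitionOf_ptrans hμ)) hτ
  obtain ⟨hσa, L, hL, _⟩ := hσP
  obtain ⟨hνa, M, hM, _⟩ := hν
  have hgal := lt_ptrans_iff hνa hM
  have hlast : stripTwo μ k (k - 1) = μ (k - 1) - 2 := if_pos (by omega)
  have hk' : stripTwo μ k k = μ k := if_neg (by omega)
  have hlow : ∀ j, j < μ (k - 1) - 2 → k ≤ ptrans (stripTwo μ k) j := by
    intro j hj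
    have := (hgal (k - 1) j).2 (by omega)
    omega
  have hhigh : ptrans (stripTwo μ k) (μ (k - 1) - 2) < k := by
    have := hgal (k - 1) (μ (k - 1) - 2)
    omega
  rw [ptrans_eq_insertPair hk hμ hstep]
  set p := μ (k - 1) - 2
  have h1 : ∀ j, j < p → k ≤ plusOne (ptrans (stripTwo μ k)) j := by
    intro j hj
    have := hlow j hj
    unfold plusOne
    split_ifs with h
    · subst h
      omega
    · exact this
  have h2 : plusOne (ptrans (stripTwo μ k)) p ≤ k := by
    unfold plusOne
    split_ifs with h
    · rw [h] at hhigh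
      omega
    · exact hhigh.le
  have hcol : orthCollapse (plusOne (insertPair (ptrans (stripTwo μ k)) p k))
      = insertPair (orthCollapse (plusOne (ptrans (stripTwo μ k)))) p k := by
    rw [← orthCollapse_insertPair hko h1 h2]
    rcases Nat.eq_zero_or_pos p with hp | hp
    · rw [hp] at hhigh ⊢
      exact orthCollapse_plusOne_insertPair_zero hνt.1 hko hhigh
    · rw [plusOne_insertPair hp]
  rw [hcol]
  obtain ⟨h3, h4⟩ := orthCollapse_bounds ha.1 hko h1 h2
  exact isUnionOf_insertPair hσa hL h3 h4
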